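/- Let K ≥ 1 and let λ, m_p, m_d, b, t_b > 0 satisfy λ·(m_p+m_d) < K·b/t_b; set δ = b/t_b − (m_p+m_d)·λ/K > 0. Let f¹, …, f^K : [0,∞) → ℝ be nonnegative Lipschitz functions (workloads) and A¹, …, A^K : [0,∞) → ℝ nondecreasing Lipschitz functions (cumulative arrival assignments) such that for almost every t > 0 at which all fᵏ and Aᵏ are differentiable: (i) Σ_k (Aᵏ)'(t) = λ; (ii) (Aᵏ)'(t) = 0 whenever fᵏ(t) > min_j fʲ(t) (arrivals are routed only to engines with least workload); and (iii) for each k with fᵏ(t) > 0, (fᵏ)'(t) = (m_p+m_d)·(Aᵏ)'(t) − b/t_b. Then max_k fᵏ(t) = 0 for every t ≥ (max_k fᵏ(0))/δ. -/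

import Mathlib

open MeasureTheory

theorem LipschitzWith.sub_le_mul_of_ae_deriv_le {g : ℝ → ℝ} {C : NNReal} (hg : LipschitzWith C g)
    {a b c : ℝ} (hab : a ≤ b) (h : ∀ᵐ x, x ∈ Set.Icc a b → deriv g x ≤ c) :
    g b - g a ≤ c * (b - a) := by
  have hac : AbsolutelyContinuousOnInterval g a b :=
    (hg.lipschitzOnWith (s := Set.uIcc a b)).absolutelyContinuousOnInterval
  rw [← hac.integral_deriv_eq_sub]
  calc ∫ x in a..b, deriv g x ≤ ∫ _ in a..b, c :=
        intervalIntegral.integral_mono_ae_restrict hab hac.intervalIntegrable_deriv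
          intervalIntegrable_const ((ae_restrict_iff' measurableSet_Icc).2 h)
    _ = c * (b - a) := by simp [mul_comm]

/-- A nonnegative Lipschitz function decreasing at rate at least `δ` while positive vanishes from
time `g 0 / δ` on. -/
theorem LipschitzWith.eq_zero_of_ae_deriv_le_neg {g : ℝ → ℝ} {C : NNReal} (hg : LipschitzWith C g)
    (hnn : ∀ t, 0 ≤ g t) {δ : ℝ} (hδ : 0 < δ)
    (h : ∀ᵐ t, 0 < t → 0 < g t → deriv g t ≤ -δ) {t : ℝ} (ht : g 0 / δ ≤ t) : g t = 0 := by
  have ht0 : 0 ≤ t := (div_nonneg (hnn 0) hδ.le).trans ht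
  have hne : ∀ᵐ x : ℝ, x ≠ 0 := by simp [ae_iff, measure_singleton]
  have hanti : ∀ s, 0 ≤ s → s ≤ t → g t ≤ g s := by
    intro s hs hst
    have := hg.sub_le_mul_of_ae_deriv_le (c := 0) hst (by
      filter_upwards [h, hne] with x hx hx0 hxm
      rcases (hnn x).eq_or_lt with h0 | h0
      · have hmin : IsLocalMin g x := Filter.Eventually.of_forall fun y => h0 ▸ hnn y
        exact hmin.deriv_eq_zero.le
      · linarith [hx (lt_of_le_of_ne (hs.trans hxm.1) hx0.symm) h0])
    linarith
  by_contra hgt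
  have hpos : 0 < g t := lt_of_le_of_ne (hnn t) (Ne.symm hgt)
  have := hg.sub_le_mul_of_ae_deriv_le (c := -δ) ht0 (by
    filter_upwards [h, hne] with x hx hx0 hxm
    exact hx (lt_of_le_of_ne hxm.1 hx0.symm) (hpos.trans_le (hanti x hxm.1 hxm.2)))
  rw [div_le_iff₀ hδ] at ht
  nlinarith

theorem LipschitzWith.finset_sup' {ι : Type*} {s : Finset ι} (hs : s.Nonempty) {f : ι → ℝ → ℝ}
    {L : ι → NNReal} (hf : ∀ i, LipschitzWith (L i) (f i)) :
    LipschitzWith (s.sup L) fun t => s.sup' hs fun i => f i t := by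
  refine LipschitzWith.of_le_add_mul _ fun x y => Finset.sup'_le _ _ fun i hi => ?_
  have h1 := (hf i).le_add_mul x y
  have h2 := Finset.le_sup' (fun i => f i y) hi
  have h3 : (L i : ℝ) ≤ (s.sup L : NNReal) := by exact_mod_cast Finset.le_sup hi
  have h4 := mul_le_mul_of_nonneg_right h3 (dist_nonneg (x := x) (y := y))
  linarith

theorem deriv_eq_of_le_of_eq {f g : ℝ → ℝ} {t : ℝ} (hf : DifferentiableAt ℝ f t)
    (hg : DifferentiableAt ℝ g t) (hle : ∀ s, f s ≤ g s) (heq : f t = g t) :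
    deriv f t = deriv g t := by
  have hmin : IsLocalMin (fun s => g s - f s) t :=
    Filter.Eventually.of_forall fun s => by simpa [heq] using hle s
  have := hmin.hasDerivAt_eq_zero (hg.hasDerivAt.sub hf.hasDerivAt)
  linarith

/-- Stability of `K` identical parallel LLM engines under the join-least-workload load-balancing
algorithm: the per-engine workloads `fᵏ` are nonnegative Lipschitz, arrivals `Aᵏ` are
nondecreasing Lipschitz with total rate `λ` routed only to engines of least workload, each busy
engine drains at rate `b/t_b − (m_p+m_d)·(Aᵏ)'`, and under `λ(m_p+m_d) < K·b/t_b` every engine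
is empty by time `(max_k fᵏ(0))/δ` with `δ = b/t_b − (m_p+m_d)·λ/K`. -/
theorem stmt5 (K : ℕ) (hK : 0 < K) (lam mp md b tb : ℝ)
    (hlam : 0 < lam) (hmp : 0 < mp) (hmd : 0 < md) (hb : 0 < b) (htb : 0 < tb)
    (hload : lam * (mp + md) < K * (b / tb))
    (f A : Fin K → ℝ → ℝ)
    (Lf LA : Fin K → NNReal)
    (hflip : ∀ k, LipschitzWith (Lf k) (f k))
    (hAlip : ∀ k, LipschitzWith (LA k) (A k))
    (hfnn : ∀ k t, 0 ≤ f k t)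
    (hAmono : ∀ k, Monotone (A k))
    (hae : ∀ᵐ t ∂(volume : Measure ℝ),
      (0 < t ∧ (∀ k, DifferentiableAt ℝ (f k) t) ∧ (∀ k, DifferentiableAt ℝ (A k) t)) →
      ((∑ k, deriv (A k) t) = lam ∧
       (∀ k, (Finset.univ.inf' ⟨⟨0, hK⟩, Finset.mem_univ _⟩ (fun j => f j t)) < f k t →
          deriv (A k) t = 0) ∧
       (∀ k, 0 < f k t →
          deriv (f k) t = (mp + md) * deriv (A k) t - b / tb))) :
    ∀ t : ℝ,
      (Finset.univ.sup' ⟨⟨0, hK⟩, Finset.mem_univ _⟩ (fun k => f k 0))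
        / (b / tb - (mp + md) * (lam / K)) ≤ t →
      (Finset.univ.sup' ⟨⟨0, hK⟩, Finset.mem_univ _⟩ (fun k => f k t)) = 0 := by
  have hKr : (0 : ℝ) < K := by exact_mod_cast hK
  have hne : (Finset.univ : Finset (Fin K)).Nonempty := ⟨⟨0, hK⟩, Finset.mem_univ _⟩
  have hδ : 0 < b / tb - (mp + md) * (lam / K) := by
    have : (mp + md) * (lam / K) < b / tb := by
      rw [← mul_div_assoc, div_lt_iff₀ hKr]
      linarith
    linarith
  have hMlip := LipschitzWith.finset_sup' hne hflip
  have hle : ∀ k s, f k s ≤ Finset.univ.sup' hne (fun k => f k s) := fun k s =>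
    Finset.le_sup' (fun k => f k s) (Finset.mem_univ k)
  intro t ht
  refine hMlip.eq_zero_of_ae_deriv_le_neg (fun s => (hfnn ⟨0, hK⟩ s).trans (hle _ s)) hδ ?_ ht
  have hfd : ∀ᵐ s, ∀ k, DifferentiableAt ℝ (f k) s :=
    ae_all_iff.2 fun k => (hflip k).ae_differentiableAt_real
  have hAd : ∀ᵐ s, ∀ k, DifferentiableAt ℝ (A k) s :=
    ae_all_iff.2 fun k => (hAlip k).ae_differentiableAt_real
  filter_upwards [hae, hfd, hAd, hMlip.ae_differentiableAt_real] with s hs hfs hAs hMs hs0 hpos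
  obtain ⟨hsum, hroute, hdrain⟩ := hs ⟨hs0, hfs, hAs⟩
  have hderiv : ∀ k, f k s = Finset.univ.sup' hne (fun k => f k s) →
      deriv (fun t => Finset.univ.sup' hne fun k => f k t) s
        = (mp + md) * deriv (A k) s - b / tb := fun k hk => by
    rw [← hdrain k (hk ▸ hpos)]
    exact (deriv_eq_of_le_of_eq (hfs k) hMs (hle k) hk).symm
  by_cases hall : ∀ k, f k s = Finset.univ.sup' hne (fun k => f k s)
  · have hall_sum := Finset.sum_congr (rfl : (Finset.univ : Finset (Fin K)) = _)
      fun k _ => hderiv k (hall k)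
    rw [Finset.sum_sub_distrib, ← Finset.mul_sum, hsum] at hall_sum
    simp only [Finset.sum_const, Finset.card_univ, Fintype.card_fin, nsmul_eq_mul] at hall_sum
    refine le_of_eq (mul_left_cancel₀ hKr.ne' ?_)
    rw [hall_sum]
    field_simp
    ring
  · obtain ⟨j, hj⟩ := not_forall.1 hall
    obtain ⟨k, -, hk⟩ := Finset.exists_mem_eq_sup' hne (fun k => f k s)
    have hA : deriv (A k) s = 0 := by
      refine hroute k ((Finset.inf'_le (fun j => f j s) (Finset.mem_univ j)).trans_lt ?_)
      exact hk ▸ lt_of_le_of_ne (hle j s) hj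
    rw [hderiv k hk.symm, hA]
    have : 0 < (mp + md) * (lam / K) := by positivity
    linarith
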